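/- (Proposition 2, multistage part.) Let ŷ : 𝒯 → ℝ^J and û : 𝒯∖{r} → ℝ be given with b_n := B_{τ(n)} ŷ_n ≥ 0 componentwise for every node n. Then the constructed pair (x^MS, η^MS) is feasible for SP-RMS(ŷ,û), and it is optimal: every feasible (x, η) of SP-RMS(ŷ,û) satisfies G(x,η) ≥ G(x^MS,η^MS). Consequently Q^M(ŷ,û) = ∑_{n∈𝒯} p_n ( f̃_n · max_{m∈𝒫(n)} ⌈b_m⌉ + λ̃_n · max_{m∈𝒞(n)} ( f_{τ(m)} · max_{l∈𝒫(m)} ⌈b_l⌉ + c_{τ(m)} · ŷ_m − û_m ) ), with the λ̃-term omitted at leaves. -/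

import Mathlib

open Finset

/-- A scenario tree with `T` stages: a finite nonempty set of nodes with a root,
a parent map fixing the root, a stage map decreasing by one along the parent map,
such that every node reaches the root by iterating the parent map, and every
non-leaf node has a child. -/
structure STree (T : ℕ) : Type 1 where
  Node : Type
  fin : Fintype Node
  deceq : DecidableEq Node
  root : Node
  parent : Node → Node
  stage : Node → ℕ
  hT : 1 ≤ T
  parent_root : parent root = root
  stage_root : stage root = 1
  stage_ge : ∀ n, 1 ≤ stage n
  stage_le : ∀ n, stage n ≤ T
  stage_parent : ∀ n, n ≠ root → stage (parent n) = stage n - 1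
  reaches_root : ∀ n, ∃ k, parent^[k] n = root
  children_ne : ∀ n, stage n ≠ T → ∃ m, m ≠ root ∧ parent m = n

attribute [instance] STree.fin STree.deceq

namespace STree

variable {T : ℕ} (S : STree T)

/-- The path set `𝒫(n) = {aᵏ(n) : k ≥ 0}` of a node. -/
def path (n : S.Node) : Finset S.Node :=
  (Finset.range T).image fun k => S.parent^[k] n

theorem path_nonempty (n : S.Node) : (S.path n).Nonempty :=
  ⟨n, Finset.mem_image.mpr ⟨0, Finset.mem_range.mpr S.hT, rfl⟩⟩

/-- The children `𝒞(n)` of a node. -/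
def children (n : S.Node) : Finset S.Node :=
  Finset.univ.filter fun m => m ≠ S.root ∧ S.parent m = n

theorem children_nonempty {n : S.Node} (h : S.stage n ≠ T) : (S.children n).Nonempty := by
  obtain ⟨m, h1, h2⟩ := S.children_ne n h
  exact ⟨m, Finset.mem_filter.mpr ⟨Finset.mem_univ m, h1, h2⟩⟩

/-- The set `𝒯ₛ` of stage-`s` nodes. -/
def stageNodes (s : ℕ) : Finset S.Node :=
  Finset.univ.filter fun n => S.stage n = s

theorem stageNodes_self_nonempty (n : S.Node) : (S.stageNodes (S.stage n)).Nonempty :=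
  ⟨n, Finset.mem_filter.mpr ⟨Finset.mem_univ n, rfl⟩⟩

end STree

section Constructions

variable {T M J : ℕ}

/-- `b_n = B_{τ(n)} ŷ_n` (componentwise). -/
noncomputable def bvec (S : STree T) (B : ℕ → Matrix (Fin M) (Fin J) ℝ)
    (yh : S.Node → Fin J → ℝ) (n : S.Node) (i : Fin M) : ℝ :=
  (B (S.stage n)).mulVec (yh n) i

/-- Componentwise maximum of `b` over all nodes of the same stage as `n`
(used for `b̄_n = max_{l ∈ 𝒯_{τ(n)}} b_l`). -/
noncomputable def stageMax (S : STree T) (b : S.Node → Fin M → ℝ) (n : S.Node) (i : Fin M) : ℝ :=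
  (S.stageNodes (S.stage n)).sup' (S.stageNodes_self_nonempty n) fun l => b l i

/-- `max_{m ∈ 𝒫(n)} ⌈b_m⌉` (componentwise). -/
noncomputable def pmc (S : STree T) (b : S.Node → Fin M → ℝ) (n : S.Node) (i : Fin M) : ℤ :=
  (S.path n).sup' (S.path_nonempty n) fun m => ⌈b m i⌉

/-- `max_{m ∈ 𝒫(n)} b_m` (componentwise, no rounding). -/
noncomputable def pm (S : STree T) (b : S.Node → Fin M → ℝ) (n : S.Node) (i : Fin M) : ℝ :=
  (S.path n).sup' (S.path_nonempty n) fun m => b m i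

end Constructions

section Substructure

variable {T M J : ℕ}

/-- Feasibility for the substructure problem SP-RMS(ŷ,û). -/
def FeasSP (S : STree T) (f : ℕ → Fin M → ℝ) (c : ℕ → Fin J → ℝ)
    (B : ℕ → Matrix (Fin M) (Fin J) ℝ)
    (yh : S.Node → Fin J → ℝ) (uh : S.Node → ℝ)
    (x : S.Node → Fin M → ℤ) (η : S.Node → ℝ) : Prop :=
  (∀ n i, 0 ≤ x n i) ∧
  (∀ n i, (B (S.stage n)).mulVec (yh n) i ≤ ∑ m ∈ S.path n, (x m i : ℝ)) ∧
  ∀ n, n ≠ S.root →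
    (∑ i, f (S.stage n) i * ∑ m ∈ S.path n, (x m i : ℝ))
      + (∑ j, c (S.stage n) j * yh n j) - uh n ≤ η (S.parent n)

/-- Objective `G(x,η) = ∑_n p_n ( f̃_n · ∑_{m∈𝒫(n)} x_m + λ̃_n η_n )` of the
substructure problem, where `f̃` and `λ̃` are the derived coefficients. -/
noncomputable def Gobj (S : STree T) (p : S.Node → ℝ) (f : ℕ → Fin M → ℝ) (lam : ℕ → ℝ)
    (x : S.Node → Fin M → ℤ) (η : S.Node → ℝ) : ℝ :=
  ∑ n, p n *
    ((∑ i, (if n = S.root then f 1 i else (1 - lam (S.stage n)) * f (S.stage n) i)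
        * ∑ m ∈ S.path n, (x m i : ℝ))
     + (if S.stage n = T then 0 else lam (S.stage n + 1)) * η n)

end Substructure

namespace STree

variable {T : ℕ} (S : STree T)

theorem two_le_stage {n : S.Node} (hn : n ≠ S.root) : 2 ≤ S.stage n := by
  have h1 := S.stage_parent n hn
  have h2 := S.stage_ge (S.parent n)
  omega

theorem stage_parent_ne {n : S.Node} (hn : n ≠ S.root) : S.stage (S.parent n) ≠ T := by
  have h1 := S.stage_parent n hn
  have h2 := S.stage_le n
  have h3 := S.two_le_stage hn
  omega

theorem iterate_parent_root (k : ℕ) : S.parent^[k] S.root = S.root :=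
  Function.iterate_fixed S.parent_root k

theorem iterate_parent_eq_root {k : ℕ} {n : S.Node} (h : S.stage n ≤ k + 1) :
    S.parent^[k] n = S.root := by
  induction k generalizing n with
  | zero =>
    change n = S.root
    by_contra hn
    have := S.two_le_stage hn
    omega
  | succ k ih =>
    by_cases hn : n = S.root
    · rw [hn, S.iterate_parent_root]
    · rw [Function.iterate_succ_apply]
      apply ih
      rw [S.stage_parent n hn]
      omega

theorem mem_path {n m : S.Node} : m ∈ S.path n ↔ ∃ k, S.parent^[k] n = m := by
  have hT := S.hT
  have hn := S.stage_le n
  refine ⟨fun h => ?_, ?_⟩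
  · obtain ⟨k, -, hk⟩ := Finset.mem_image.mp h
    exact ⟨k, hk⟩
  · rintro ⟨k, rfl⟩
    by_cases hk : k < T
    · exact Finset.mem_image.mpr ⟨k, Finset.mem_range.mpr hk, rfl⟩
    · refine Finset.mem_image.mpr ⟨T - 1, Finset.mem_range.mpr (by omega), ?_⟩
      rw [S.iterate_parent_eq_root (k := T - 1) (by omega),
        S.iterate_parent_eq_root (k := k) (by omega)]

theorem self_mem_path (n : S.Node) : n ∈ S.path n :=
  S.mem_path.mpr ⟨0, rfl⟩

theorem path_root : S.path S.root = {S.root} := by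
  ext m
  simp [S.mem_path, S.iterate_parent_root, eq_comm]

theorem path_eq_insert (n : S.Node) : S.path n = insert n (S.path (S.parent n)) := by
  ext m
  rw [Finset.mem_insert, S.mem_path, S.mem_path]
  constructor
  · rintro ⟨_ | k, rfl⟩
    · exact Or.inl rfl
    · exact Or.inr ⟨k, rfl⟩
  · rintro (rfl | ⟨k, rfl⟩)
    · exact ⟨0, rfl⟩
    · exact ⟨k + 1, rfl⟩

theorem path_subset_path {n m : S.Node} (h : m ∈ S.path n) : S.path m ⊆ S.path n := by
  obtain ⟨k, rfl⟩ := S.mem_path.mp h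
  intro l hl
  obtain ⟨j, rfl⟩ := S.mem_path.mp hl
  exact S.mem_path.mpr ⟨j + k, Function.iterate_add_apply _ _ _ _⟩

theorem stage_le_of_mem_path {n m : S.Node} (h : m ∈ S.path n) : S.stage m ≤ S.stage n := by
  obtain ⟨k, rfl⟩ := S.mem_path.mp h
  clear h
  induction k with
  | zero => exact le_rfl
  | succ k ih =>
    rw [Function.iterate_succ_apply']
    by_cases hr : S.parent^[k] n = S.root
    · rwa [hr, S.parent_root, ← hr]
    · rw [S.stage_parent _ hr]
      omega

theorem notMem_path_parent {n : S.Node} (hn : n ≠ S.root) : n ∉ S.path (S.parent n) := by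
  intro h
  have h1 := S.stage_le_of_mem_path h
  have h2 := S.stage_parent n hn
  have h3 := S.two_le_stage hn
  omega

theorem parent_induction {P : S.Node → Prop} (root : P S.root)
    (step : ∀ n, n ≠ S.root → P (S.parent n) → P n) (n : S.Node) : P n := by
  obtain ⟨k, hk⟩ := S.reaches_root n
  induction k generalizing n with
  | zero => exact (show n = S.root from hk) ▸ root
  | succ k ih =>
    by_cases hn : n = S.root
    · exact hn ▸ root
    · exact step n hn (ih _ hk)

end STree

section PathMaximum

variable {T M : ℕ} (S : STree T) (b : S.Node → Fin M → ℝ)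

theorem pmc_root (i : Fin M) : pmc S b S.root i = ⌈b S.root i⌉ := by
  simp [pmc, S.path_root]

theorem le_pmc {n m : S.Node} (h : m ∈ S.path n) (i : Fin M) : ⌈b m i⌉ ≤ pmc S b n i :=
  Finset.le_sup' (fun m => ⌈b m i⌉) h

theorem pmc_parent_le (n : S.Node) (i : Fin M) : pmc S b (S.parent n) i ≤ pmc S b n i := by
  refine Finset.sup'_le _ _ fun m hm => le_pmc S b ?_ i
  rw [S.path_eq_insert]
  exact Finset.mem_insert_of_mem hm

/-- The increments of the path maximum sum up to it along each path. -/
theorem sum_path_eq_pmc {x : S.Node → Fin M → ℤ}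
    (hroot : ∀ i, x S.root i = ⌈b S.root i⌉)
    (hstep : ∀ n, n ≠ S.root → ∀ i, x n i = pmc S b n i - pmc S b (S.parent n) i)
    (n : S.Node) (i : Fin M) : ∑ m ∈ S.path n, x m i = pmc S b n i := by
  induction n using S.parent_induction with
  | root => rw [S.path_root, Finset.sum_singleton, hroot, pmc_root]
  | step n hn ih =>
    rw [S.path_eq_insert, Finset.sum_insert (S.notMem_path_parent hn), ih, hstep n hn]
    ring

/-- Nonnegative integer increments covering `b` dominate the path maximum of `⌈b⌉`. -/
theorem pmc_le_sum_path {x : S.Node → Fin M → ℤ} (hx : ∀ n i, 0 ≤ x n i)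
    (hcov : ∀ n i, b n i ≤ ∑ m ∈ S.path n, (x m i : ℝ)) (n : S.Node) (i : Fin M) :
    pmc S b n i ≤ ∑ m ∈ S.path n, x m i := by
  refine Finset.sup'_le _ _ fun m hm => ?_
  calc ⌈b m i⌉ ≤ ∑ l ∈ S.path m, x l i := by
        rw [Int.ceil_le]
        exact_mod_cast hcov m i
    _ ≤ ∑ l ∈ S.path n, x l i :=
        Finset.sum_le_sum_of_subset_of_nonneg (S.path_subset_path hm) fun l _ _ => hx l i

end PathMaximum

/-- Proposition 2, multistage part: the constructed pair
`(x^MS, η^MS)` is feasible and optimal for SP-RMS(ŷ,û), and consequently the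
optimal value `Q^M(ŷ,û)` equals the stated closed form. -/
theorem sp_rms_solution {T M J : ℕ} (S : STree T)
    (p : S.Node → ℝ) (f : ℕ → Fin M → ℝ) (c : ℕ → Fin J → ℝ)
    (B : ℕ → Matrix (Fin M) (Fin J) ℝ) (lam : ℕ → ℝ)
    (hp : ∀ n, 0 ≤ p n)
    (hp1 : ∀ s, 1 ≤ s → s ≤ T → ∑ n ∈ S.stageNodes s, p n = 1)
    (hpc : ∀ n, S.stage n ≠ T → ∑ m ∈ S.children n, p m = p n)
    (hf : ∀ s, 1 ≤ s → s ≤ T → ∀ i, 0 ≤ f s i)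
    (hlam : ∀ s, 2 ≤ s → s ≤ T → 0 ≤ lam s ∧ lam s ≤ 1)
    (yh : S.Node → Fin J → ℝ) (uh : S.Node → ℝ)
    (hb : ∀ n i, 0 ≤ bvec S B yh n i)
    (xMS : S.Node → Fin M → ℤ) (etaMS : S.Node → ℝ)
    (hxr : ∀ i, xMS S.root i = ⌈bvec S B yh S.root i⌉)
    (hxn : ∀ n, n ≠ S.root → ∀ i,
      xMS n i = pmc S (bvec S B yh) n i - pmc S (bvec S B yh) (S.parent n) i)
    (heta : ∀ n (hn : S.stage n ≠ T), etaMS n =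
      (S.children n).sup' (S.children_nonempty hn) fun m =>
        (∑ i, f (S.stage m) i * ∑ l ∈ S.path m, (xMS l i : ℝ))
          + (∑ j, c (S.stage m) j * yh m j) - uh m) :
    FeasSP S f c B yh uh xMS etaMS ∧
    (∀ x η, FeasSP S f c B yh uh x η → Gobj S p f lam xMS etaMS ≤ Gobj S p f lam x η) ∧
    sInf {v : ℝ | ∃ x η, FeasSP S f c B yh uh x η ∧ v = Gobj S p f lam x η} =
      ∑ n, p n *
        ((∑ i, (if n = S.root then f 1 i else (1 - lam (S.stage n)) * f (S.stage n) i) *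
            ((pmc S (bvec S B yh) n i : ℝ)))
         + (if hn : S.stage n = T then 0 else lam (S.stage n + 1) *
             (S.children n).sup' (S.children_nonempty hn) fun m =>
               (∑ i, f (S.stage m) i * (pmc S (bvec S B yh) m i : ℝ))
                 + (∑ j, c (S.stage m) j * yh m j) - uh m)) := by
  have hsum (n : S.Node) (i : Fin M) :
      ∑ m ∈ S.path n, (xMS m i : ℝ) = (pmc S (bvec S B yh) n i : ℝ) := by
    exact_mod_cast sum_path_eq_pmc S _ hxr hxn n i
  have hfeas : FeasSP S f c B yh uh xMS etaMS := by
    refine ⟨fun n i => ?_, fun n i => ?_, fun n hn => ?_⟩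
    · by_cases hn : n = S.root
      · rw [hn, hxr]
        exact Int.ceil_nonneg (hb _ _)
      · rw [hxn n hn]
        exact sub_nonneg.mpr (pmc_parent_le S _ n i)
    · rw [hsum]
      exact Int.ceil_le.mp (le_pmc S (bvec S B yh) (S.self_mem_path n) i)
    · rw [heta _ (S.stage_parent_ne hn)]
      exact Finset.le_sup' (fun m =>
        (∑ i, f (S.stage m) i * ∑ l ∈ S.path m, (xMS l i : ℝ))
          + (∑ j, c (S.stage m) j * yh m j) - uh m)
        (Finset.mem_filter.mpr ⟨Finset.mem_univ n, hn, rfl⟩)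
  have hopt : ∀ x η, FeasSP S f c B yh uh x η →
      Gobj S p f lam xMS etaMS ≤ Gobj S p f lam x η := by
    rintro x η ⟨hx, hcov, hη⟩
    have hle (n : S.Node) (i : Fin M) :
        ∑ m ∈ S.path n, (xMS m i : ℝ) ≤ ∑ m ∈ S.path n, (x m i : ℝ) := by
      rw [hsum]
      exact_mod_cast pmc_le_sum_path S (bvec S B yh) hx hcov n i
    refine Finset.sum_le_sum fun n _ => mul_le_mul_of_nonneg_left (add_le_add ?_ ?_) (hp n)
    · refine Finset.sum_le_sum fun i _ => mul_le_mul_of_nonneg_left (hle n i) ?_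
      split_ifs with hn
      · exact hf 1 le_rfl S.hT i
      · exact mul_nonneg
          (sub_nonneg.mpr (hlam _ (S.two_le_stage hn) (S.stage_le n)).2)
          (hf _ (S.stage_ge n) (S.stage_le n) i)
    · split_ifs with hn
      · simp
      · have h1 := S.stage_ge n
        have h2 := S.stage_le n
        refine mul_le_mul_of_nonneg_left ?_ (hlam _ (by omega) (by omega)).1
        rw [heta n hn]
        refine Finset.sup'_le _ _ fun m hm => ?_
        obtain ⟨-, hmr, rfl⟩ := Finset.mem_filter.mp hm
        refine le_trans ?_ (hη m hmr)
        gcongr ?_ + _ - _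
        exact Finset.sum_le_sum fun i _ =>
          mul_le_mul_of_nonneg_left (hle m i) (hf _ (S.stage_ge m) (S.stage_le m) i)
  refine ⟨hfeas, hopt, ?_⟩
  have hleast : IsLeast {v : ℝ | ∃ x η, FeasSP S f c B yh uh x η ∧ v = Gobj S p f lam x η}
      (Gobj S p f lam xMS etaMS) := by
    refine ⟨⟨_, _, hfeas, rfl⟩, ?_⟩
    rintro _ ⟨x, η, h, rfl⟩
    exact hopt x η h
  rw [hleast.csInf_eq, Gobj]
  refine Finset.sum_congr rfl fun n _ => ?_
  simp only [hsum] at heta ⊢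
  by_cases hn : S.stage n = T
  · simp [hn]
  · simp only [hn, if_false, dite_false, heta n hn]
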